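/- arXiv:1907.03640 — 7 statements merged into one kernel-verified Lean document; each statement's English description precedes it below -/
import Mathlib

section
/- Let n ∈ ℕ, let x, y ∈ ℝ, let r ∈ ℕ with r ≥ 1 and let u_1, …, u_r ∈ ℝ. Then the n-th derivative at t = 0 of the function t ↦ exp(x t + Σ_{j=1}^r u_j t^j) · cos(y t) equals Σ_{j=0}^{⌊n/2⌋} (-1)^j (n choose 2j) y^{2j} · g^{(n-2j)}(0), where g(t) = exp(x t + Σ_{j=1}^r u_j t^j). (Equivalently, k₁(n; x, y, u, r) = Σ_{j=0}^{⌊n/2⌋} (-1)^j (n choose 2j) y^{2j} H_{n-2j}((x+u_1, u_2, …, u_r), r).) -/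
theorem iteratedDeriv_two_mul_cos_mul_zero (y : ℝ) (j : ℕ) :
    iteratedDeriv (2 * j) (fun t : ℝ => Real.cos (y * t)) 0 = (-1) ^ j * y ^ (2 * j) := by
  rw [iteratedDeriv_comp_const_mul Real.contDiff_cos, Real.iteratedDeriv_even_cos]
  simp [mul_comm]

theorem iteratedDeriv_two_mul_add_one_cos_mul_zero (y : ℝ) (j : ℕ) :
    iteratedDeriv (2 * j + 1) (fun t : ℝ => Real.cos (y * t)) 0 = 0 := by
  rw [iteratedDeriv_comp_const_mul Real.contDiff_cos, Real.iteratedDeriv_odd_cos]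
  simp

theorem iteratedDeriv_mul_cos_mul_zero {n : ℕ} {g : ℝ → ℝ} (hg : ContDiffAt ℝ n g 0) (y : ℝ) :
    iteratedDeriv n (fun t : ℝ => g t * Real.cos (y * t)) 0
    = ∑ j ∈ Finset.range (n / 2 + 1),
        (-1 : ℝ) ^ j * (n.choose (2 * j) : ℝ) * y ^ (2 * j) * iteratedDeriv (n - 2 * j) g 0 := by
  have hcos : ContDiffAt ℝ n (fun t : ℝ => Real.cos (y * t)) 0 := by fun_prop
  simp_rw [mul_comm (g _)]
  rw [iteratedDeriv_fun_mul hcos hg]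
  symm
  refine Finset.sum_of_injOn (fun j => 2 * j) (fun a _ b _ h => by simpa using h)
    (fun j hj => ?_) (fun i hi hi' => ?_) (fun j _ => ?_)
  · simp only [Finset.coe_range, Set.mem_Iio] at hj ⊢
    omega
  · obtain ⟨j, rfl | rfl⟩ := i.even_or_odd'
    · refine absurd ⟨j, ?_, rfl⟩ hi'
      simp only [Finset.coe_range, Set.mem_Iio, Finset.mem_range] at hi ⊢
      omega
    · rw [iteratedDeriv_two_mul_add_one_cos_mul_zero]
      simp
  · rw [iteratedDeriv_two_mul_cos_mul_zero]
    ring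

theorem stmt_0 (n : ℕ) (x y : ℝ) (r : ℕ) (hr : 1 ≤ r) (u : ℕ → ℝ) :
    iteratedDeriv n
      (fun t : ℝ => Real.exp (x * t + ∑ j ∈ Finset.Icc 1 r, u j * t ^ j) * Real.cos (y * t)) 0
    = ∑ j ∈ Finset.range (n / 2 + 1),
        (-1 : ℝ) ^ j * (n.choose (2 * j) : ℝ) * y ^ (2 * j) *
          iteratedDeriv (n - 2 * j)
            (fun t : ℝ => Real.exp (x * t + ∑ j ∈ Finset.Icc 1 r, u j * t ^ j)) 0 :=
  iteratedDeriv_mul_cos_mul_zero (by fun_prop) y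
end

section
/- Let n ∈ ℕ, let x, y ∈ ℝ, let r ∈ ℕ with r ≥ 1 and let u_1, …, u_r ∈ ℝ. Then the n-th derivative at t = 0 of the function t ↦ exp(x t + Σ_{j=1}^r u_j t^j) · sin(y t) equals Σ_{j=0}^{⌊(n-1)/2⌋} (-1)^j (n choose 2j+1) y^{2j+1} · g^{(n-1-2j)}(0), where g(t) = exp(x t + Σ_{j=1}^r u_j t^j). (Equivalently, k₂(n; x, y, u, r) = Σ_{j=0}^{⌊(n-1)/2⌋} (-1)^j (n choose 2j+1) y^{2j+1} H_{n-1-2j}((x+u_1, u_2, …, u_r), r).) -/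
open Finset

theorem Finset.sum_range_two_mul_add_one_of_even_eq_zero {M : Type*} [AddCommMonoid M]
    (F : ℕ → M) (hF : ∀ j, F (2 * j) = 0) (k : ℕ) :
    ∑ i ∈ Finset.range (2 * k + 1), F i = ∑ j ∈ Finset.range k, F (2 * j + 1) := by
  induction k with
  | zero => simpa using hF 0
  | succ k ih =>
    rw [show 2 * (k + 1) + 1 = 2 * k + 1 + 1 + 1 by ring, Finset.sum_range_succ,
      Finset.sum_range_succ, ih, Finset.sum_range_succ _ k,
      show 2 * k + 1 + 1 = 2 * (k + 1) by ring, hF, add_zero]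

theorem iteratedDeriv_sin_const_mul (y : ℝ) (i : ℕ) :
    iteratedDeriv i (fun t : ℝ => Real.sin (y * t)) 0 = y ^ i * iteratedDeriv i Real.sin 0 := by
  simpa using congrFun (iteratedDeriv_comp_const_mul (n := i) Real.contDiff_sin y) 0

/-- Leibniz rule at `0` for a product with `sin (y t)`, with the vanishing even-order
derivatives of the sine removed. -/
theorem iteratedDeriv_mul_sin_const_mul_zero (n : ℕ) (y : ℝ) {g : ℝ → ℝ}
    (hg : ContDiff ℝ n g) :
    iteratedDeriv n (fun t : ℝ => g t * Real.sin (y * t)) 0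
    = ∑ j ∈ Finset.range ((n - 1) / 2 + 1),
        (-1 : ℝ) ^ j * (n.choose (2 * j + 1) : ℝ) * y ^ (2 * j + 1) *
          iteratedDeriv (n - 1 - 2 * j) g 0 := by
  have hs : ContDiff ℝ n (fun t : ℝ => Real.sin (y * t)) := by fun_prop
  simp_rw [mul_comm (g _)]
  rw [iteratedDeriv_fun_mul hs.contDiffAt hg.contDiffAt]
  rw [Finset.sum_subset (s₂ := Finset.range (2 * ((n - 1) / 2 + 1) + 1)),
    Finset.sum_range_two_mul_add_one_of_even_eq_zero]
  · refine Finset.sum_congr rfl fun j _ => ?_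
    rw [iteratedDeriv_sin_const_mul, Real.iteratedDeriv_odd_sin,
      show n - (2 * j + 1) = n - 1 - 2 * j by omega]
    simp only [Pi.mul_apply, Pi.pow_apply, Pi.neg_apply, Pi.one_apply, Real.cos_zero]
    ring
  · intro j
    rw [iteratedDeriv_sin_const_mul, Real.iteratedDeriv_even_sin]
    simp
  · intro i hi
    simp only [Finset.mem_range] at hi ⊢
    omega
  · intro i _ hi
    rw [Nat.choose_eq_zero_of_lt (by rw [Finset.mem_range] at hi; omega)]
    simp

theorem stmt_1 (n : ℕ) (x y : ℝ) (r : ℕ) (hr : 1 ≤ r) (u : ℕ → ℝ) :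
    iteratedDeriv n
      (fun t : ℝ => Real.exp (x * t + ∑ j ∈ Finset.Icc 1 r, u j * t ^ j) * Real.sin (y * t)) 0
    = ∑ j ∈ Finset.range ((n - 1) / 2 + 1),
        (-1 : ℝ) ^ j * (n.choose (2 * j + 1) : ℝ) * y ^ (2 * j + 1) *
          iteratedDeriv (n - 1 - 2 * j)
            (fun t : ℝ => Real.exp (x * t + ∑ j ∈ Finset.Icc 1 r, u j * t ^ j)) 0 :=
  iteratedDeriv_mul_sin_const_mul_zero n y (by fun_prop)
end

section
/- Let n ∈ ℕ, let x, y ∈ ℝ and set w = x + iy ∈ ℂ; let r ∈ ℕ with r ≥ 1 and u_1, …, u_r ∈ ℝ. Then the n-th derivative at t = 0 of the complex-valued function t ↦ exp(w t + Σ_{j=1}^r u_j t^j) (t real) equals Σ_{j=0}^{⌊n/2⌋} (-1)^j (n choose 2j) y^{2j} g^{(n-2j)}(0) + i · Σ_{j=0}^{⌊(n-1)/2⌋} (-1)^j (n choose 2j+1) y^{2j+1} g^{(n-1-2j)}(0), where g(t) = exp(x t + Σ_{j=1}^r u_j t^j) is real-valued. -/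
open Finset

/-- A sum over `range n` splits into its even-indexed and odd-indexed parts. -/
theorem sum_range_eq_sum_even_add_sum_odd {M : Type*} [AddCommMonoid M] (f : ℕ → M) (n : ℕ) :
    ∑ k ∈ range n, f k =
      ∑ j ∈ range ((n + 1) / 2), f (2 * j) + ∑ j ∈ range (n / 2), f (2 * j + 1) := by
  induction n with
  | zero => simp
  | succ n ih =>
    rw [sum_range_succ, ih]
    rcases Nat.even_or_odd' n with ⟨m, rfl | rfl⟩
    · rw [show (2 * m + 1) / 2 = m by omega, show 2 * m / 2 = m by omega,
        show (2 * m + 1 + 1) / 2 = m + 1 by omega, sum_range_succ _ m, add_right_comm]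
    · rw [show (2 * m + 1 + 1) / 2 = m + 1 by omega, show (2 * m + 1) / 2 = m by omega,
        show (2 * m + 1 + 1 + 1) / 2 = m + 1 by omega,
        sum_range_succ (fun j => f (2 * j + 1)) m, add_assoc]

/-- Iterated derivatives of `t ↦ exp (c t)` along the real line, for complex `c`. -/
theorem iteratedDeriv_cexp_const_mul_ofReal (c : ℂ) (n : ℕ) :
    iteratedDeriv n (fun t : ℝ => Complex.exp (c * t)) =
      fun t : ℝ => c ^ n * Complex.exp (c * t) := by
  induction n with
  | zero => simp
  | succ n ih =>
    rw [iteratedDeriv_succ, ih]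
    funext t
    have h : HasDerivAt (fun t : ℝ => c * (t : ℂ)) (c * 1) t :=
      (Complex.ofRealCLM.hasDerivAt (x := t)).const_mul c
    rw [(h.cexp.const_mul (c ^ n)).deriv]
    ring

/-- Iterated derivatives commute with the coercion from `ℝ` to `ℂ`. -/
theorem iteratedDeriv_ofReal_comp {g : ℝ → ℝ} (hg : ContDiff ℝ ⊤ g) (n : ℕ) :
    iteratedDeriv n (fun t : ℝ => (g t : ℂ)) = fun t => ((iteratedDeriv n g t : ℝ) : ℂ) := by
  induction n with
  | zero => simp
  | succ n ih =>
    rw [iteratedDeriv_succ, ih, iteratedDeriv_succ]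
    funext t
    have hd : DifferentiableAt ℝ (iteratedDeriv n g) t :=
      (hg.differentiable_iteratedDeriv n (by exact_mod_cast WithTop.coe_lt_top _)) t
    exact hd.hasDerivAt.ofReal_comp.deriv

/-- The real and imaginary parts of a binomial-type sum in powers of `I * y`. -/
theorem sum_choose_mul_I_mul_pow (n : ℕ) (y : ℝ) (a : ℕ → ℝ) :
    ∑ k ∈ range (n + 1), (n.choose k : ℂ) * (Complex.I * y) ^ k * (a (n - k) : ℂ) =
      (∑ j ∈ range (n / 2 + 1),
        (-1 : ℝ) ^ j * (n.choose (2 * j) : ℝ) * y ^ (2 * j) * a (n - 2 * j) : ℝ) +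
      Complex.I * (∑ j ∈ range ((n - 1) / 2 + 1),
        (-1 : ℝ) ^ j * (n.choose (2 * j + 1) : ℝ) * y ^ (2 * j + 1) * a (n - 1 - 2 * j) : ℝ) := by
  rcases Nat.eq_zero_or_pos n with rfl | hn
  · simp
  rw [sum_range_eq_sum_even_add_sum_odd, show (n + 1 + 1) / 2 = n / 2 + 1 by omega,
    show (n + 1) / 2 = (n - 1) / 2 + 1 by omega]
  push_cast
  rw [mul_sum]
  congr 1 <;> refine sum_congr rfl fun j _ => ?_
  · rw [mul_pow, pow_mul Complex.I, Complex.I_sq]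
    ring
  · rw [mul_pow, pow_succ Complex.I, pow_mul Complex.I, Complex.I_sq,
      show n - (2 * j + 1) = n - 1 - 2 * j by omega]
    ring

theorem stmt_2 (n : ℕ) (x y : ℝ) (w : ℂ) (hw : w = x + Complex.I * y)
    (r : ℕ) (hr : 1 ≤ r) (u : ℕ → ℝ) :
    iteratedDeriv n
      (fun t : ℝ => Complex.exp (w * t + ∑ j ∈ Finset.Icc 1 r, (u j : ℂ) * (t : ℂ) ^ j)) 0
    = (∑ j ∈ Finset.range (n / 2 + 1),
        (-1 : ℝ) ^ j * (n.choose (2 * j) : ℝ) * y ^ (2 * j) *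
          iteratedDeriv (n - 2 * j)
            (fun t : ℝ => Real.exp (x * t + ∑ j ∈ Finset.Icc 1 r, u j * t ^ j)) 0 : ℝ)
      + Complex.I *
        (∑ j ∈ Finset.range ((n - 1) / 2 + 1),
          (-1 : ℝ) ^ j * (n.choose (2 * j + 1) : ℝ) * y ^ (2 * j + 1) *
            iteratedDeriv (n - 1 - 2 * j)
              (fun t : ℝ => Real.exp (x * t + ∑ j ∈ Finset.Icc 1 r, u j * t ^ j)) 0 : ℝ) := by
  set g : ℝ → ℝ := fun t => Real.exp (x * t + ∑ j ∈ Finset.Icc 1 r, u j * t ^ j) with hg_def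
  have hg : ContDiff ℝ ⊤ g := by fun_prop
  have hfactor : (fun t : ℝ =>
      Complex.exp (w * t + ∑ j ∈ Finset.Icc 1 r, (u j : ℂ) * (t : ℂ) ^ j)) =
      fun t : ℝ => Complex.exp (Complex.I * y * t) * (g t : ℂ) := by
    funext t
    rw [hg_def, hw, Complex.ofReal_exp, ← Complex.exp_add]
    push_cast
    ring_nf
  have hE : ContDiff ℝ n (fun t : ℝ => Complex.exp (Complex.I * y * t)) :=
    (contDiff_const.mul Complex.ofRealCLM.contDiff).cexp
  have hG : ContDiff ℝ n (fun t : ℝ => (g t : ℂ)) :=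
    Complex.ofRealCLM.contDiff.comp (hg.of_le le_top)
  rw [hfactor, iteratedDeriv_fun_mul hE.contDiffAt hG.contDiffAt,
    ← sum_choose_mul_I_mul_pow n y (fun m => iteratedDeriv m g 0)]
  refine sum_congr rfl fun k _ => ?_
  rw [iteratedDeriv_cexp_const_mul_ofReal, iteratedDeriv_ofReal_comp hg]
  simp
end

section
/- Let n ∈ ℕ, let x, y ∈ ℝ, let r ∈ ℕ with r ≥ 1 and u_1, …, u_r ∈ ℝ. Then the n-th derivative at t = 0 of t ↦ exp(x t + Σ_{j=1}^r u_j t^j) · cos(y t) equals Σ_{j=0}^{n} (n choose j) · C_j(x, y) · H_{n-j}(u, r), i.e. k₁(n; x, y, u, r) = Σ_{j=0}^{n} (n choose j) C_j(x, y) H_{n-j}(u, r). -/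
open Finset

/-- The polynomials `C_j(x, y)` from the paper. -/
def Cpoly (j : ℕ) (x y : ℝ) : ℝ :=
  ∑ k ∈ Finset.range (j / 2 + 1), (-1 : ℝ) ^ k * (j.choose (2 * k) : ℝ) * x ^ (j - 2 * k) * y ^ (2 * k)

/-- `C_j(x, y)` is the `j`-th derivative at `t = 0` of `cos (y t) * exp (x t)`. -/
theorem iteratedDeriv_cos_mul_exp_zero (j : ℕ) (x y : ℝ) :
    iteratedDeriv j (fun t : ℝ => Real.cos (y * t) * Real.exp (x * t)) 0 = Cpoly j x y := by
  rw [iteratedDeriv_fun_mul (by fun_prop) (by fun_prop)]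
  simp only [iteratedDeriv_comp_const_mul Real.contDiff_cos, iteratedDeriv_exp_const_mul, mul_zero,
    Real.exp_zero, mul_one]
  refine (Finset.sum_of_injOn (2 * ·) ?_ ?_ ?_ ?_).symm
  · intro a _ b _ h
    grind
  · intro k hk
    grind
  · intro i hi hne
    have hodd : Odd i := by
      by_contra h
      obtain ⟨k, rfl⟩ := even_iff_two_dvd.mp (Nat.not_odd_iff_even.mp h)
      exact hne ⟨k, by grind, rfl⟩
    obtain ⟨k, rfl⟩ := hodd
    simp
  · intro k _
    simp [Real.iteratedDeriv_even_cos]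
    ring

theorem stmt_3 (n : ℕ) (x y : ℝ) (r : ℕ) (hr : 1 ≤ r) (u : ℕ → ℝ) :
    iteratedDeriv n
      (fun t : ℝ => Real.exp (x * t + ∑ j ∈ Finset.Icc 1 r, u j * t ^ j) * Real.cos (y * t)) 0
    = ∑ j ∈ Finset.range (n + 1),
        (n.choose j : ℝ) * Cpoly j x y *
          iteratedDeriv (n - j) (fun t : ℝ => Real.exp (∑ k ∈ Finset.Icc 1 r, u k * t ^ k)) 0 := by
  have hfactor : (fun t : ℝ =>
      Real.exp (x * t + ∑ j ∈ Finset.Icc 1 r, u j * t ^ j) * Real.cos (y * t)) =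
      fun t => (Real.cos (y * t) * Real.exp (x * t)) *
        Real.exp (∑ k ∈ Finset.Icc 1 r, u k * t ^ k) := by
    ext t
    rw [Real.exp_add]
    ring
  rw [hfactor, iteratedDeriv_fun_mul (by fun_prop) (by fun_prop)]
  simp only [iteratedDeriv_cos_mul_exp_zero]
end

section
/- Let n ∈ ℕ, let x, y ∈ ℝ, let r ∈ ℕ with r ≥ 1 and u_1, …, u_r ∈ ℝ. Then the n-th derivative at t = 0 of t ↦ exp(x t + Σ_{j=1}^r u_j t^j) · sin(y t) equals Σ_{j=0}^{n} (n choose j) · S_j(x, y) · H_{n-j}(u, r), i.e. k₂(n; x, y, u, r) = Σ_{j=0}^{n} (n choose j) S_j(x, y) H_{n-j}(u, r). -/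
open Finset

/-- The polynomials `S_j(x, y)` from the paper. -/
def Spoly (j : ℕ) (x y : ℝ) : ℝ :=
  ∑ k ∈ Finset.range ((j - 1) / 2 + 1),
    (-1 : ℝ) ^ k * (j.choose (2 * k + 1) : ℝ) * x ^ (j - 2 * k - 1) * y ^ (2 * k + 1)

theorem sum_range_two_mul_eq {M : Type*} [AddCommMonoid M] (f : ℕ → M) (N : ℕ) :
    ∑ m ∈ Finset.range (2 * N), f m = ∑ k ∈ Finset.range N, (f (2 * k) + f (2 * k + 1)) := by
  induction N with
  | zero => simp
  | succ N ih =>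
    rw [show 2 * (N + 1) = 2 * N + 1 + 1 by ring, Finset.sum_range_succ, Finset.sum_range_succ,
      ih, Finset.sum_range_succ, add_assoc]

theorem Spoly_eq_im (j : ℕ) (x y : ℝ) :
    Spoly j x y = (((x : ℂ) + y * Complex.I) ^ j).im := by
  have hS : Spoly j x y = ∑ k ∈ Finset.range (j + 1),
      (-1 : ℝ) ^ k * (j.choose (2 * k + 1) : ℝ) * x ^ (j - 2 * k - 1) * y ^ (2 * k + 1) := by
    refine Finset.sum_subset (Finset.range_subset_range.2 (by omega)) fun k _ hk => ?_
    rw [Finset.mem_range] at hk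
    simp [Nat.choose_eq_zero_of_lt (show j < 2 * k + 1 by omega)]
  have hpow : ((x : ℂ) + y * Complex.I) ^ j = ∑ m ∈ Finset.range (2 * (j + 1)),
      (y * Complex.I) ^ m * (x : ℂ) ^ (j - m) * (j.choose m : ℂ) := by
    rw [add_comm, add_pow]
    refine Finset.sum_subset (Finset.range_subset_range.2 (by omega)) fun m _ hm => ?_
    rw [Finset.mem_range] at hm
    simp [Nat.choose_eq_zero_of_lt (show j < m by omega)]
  rw [hS, hpow, sum_range_two_mul_eq, Complex.im_sum]
  refine Finset.sum_congr rfl fun k _ => ?_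
  have heven : (y * Complex.I) ^ (2 * k) * (x : ℂ) ^ (j - 2 * k) * (j.choose (2 * k) : ℂ)
      = (((-1) ^ k * y ^ (2 * k) * x ^ (j - 2 * k) * (j.choose (2 * k) : ℝ) : ℝ) : ℂ) := by
    rw [mul_pow, pow_mul Complex.I, Complex.I_sq]
    push_cast
    ring
  have hodd : (y * Complex.I) ^ (2 * k + 1) * (x : ℂ) ^ (j - (2 * k + 1))
        * (j.choose (2 * k + 1) : ℂ)
      = (((-1) ^ k * (j.choose (2 * k + 1) : ℝ) * x ^ (j - 2 * k - 1) * y ^ (2 * k + 1) : ℝ) : ℂ)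
        * Complex.I := by
    rw [mul_pow, pow_succ Complex.I, pow_mul Complex.I, Complex.I_sq, Nat.sub_sub]
    push_cast
    ring
  rw [heven, hodd, Complex.add_im, Complex.ofReal_im, Complex.im_ofReal_mul, Complex.I_im]
  ring

theorem iteratedDeriv_exp_mul_sin (j : ℕ) (x y : ℝ) :
    iteratedDeriv j (fun t : ℝ => Real.exp (x * t) * Real.sin (y * t)) = fun t =>
      Real.exp (x * t) * ((((x : ℂ) + y * Complex.I) ^ j).re * Real.sin (y * t)
        + (((x : ℂ) + y * Complex.I) ^ j).im * Real.cos (y * t)) := by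
  induction j with
  | zero => simp
  | succ j ih =>
    rw [iteratedDeriv_succ, ih]
    funext t
    have hx : HasDerivAt (fun t : ℝ => x * t) x t := by simpa using (hasDerivAt_id t).const_mul x
    have hy : HasDerivAt (fun t : ℝ => y * t) y t := by simpa using (hasDerivAt_id t).const_mul y
    rw [(hx.exp.fun_mul ((hy.sin.const_mul _).fun_add (hy.cos.const_mul _))).deriv, pow_succ]
    simp only [Complex.mul_re, Complex.mul_im, Complex.add_re, Complex.add_im, Complex.ofReal_re,
      Complex.ofReal_im, Complex.I_re, Complex.I_im]
    ring

theorem iteratedDeriv_exp_mul_sin_zero (j : ℕ) (x y : ℝ) :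
    iteratedDeriv j (fun t : ℝ => Real.exp (x * t) * Real.sin (y * t)) 0 = Spoly j x y := by
  simp [iteratedDeriv_exp_mul_sin, Spoly_eq_im]

theorem stmt_4 (n : ℕ) (x y : ℝ) (r : ℕ) (hr : 1 ≤ r) (u : ℕ → ℝ) :
    iteratedDeriv n
      (fun t : ℝ => Real.exp (x * t + ∑ j ∈ Finset.Icc 1 r, u j * t ^ j) * Real.sin (y * t)) 0
    = ∑ j ∈ Finset.range (n + 1),
        (n.choose j : ℝ) * Spoly j x y *
          iteratedDeriv (n - j) (fun t : ℝ => Real.exp (∑ k ∈ Finset.Icc 1 r, u k * t ^ k)) 0 := by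
  have hfactor : (fun t : ℝ =>
        Real.exp (x * t + ∑ j ∈ Finset.Icc 1 r, u j * t ^ j) * Real.sin (y * t))
      = fun t => (Real.exp (x * t) * Real.sin (y * t)) *
        Real.exp (∑ k ∈ Finset.Icc 1 r, u k * t ^ k) := by
    funext t
    rw [Real.exp_add]
    ring
  rw [hfactor, iteratedDeriv_fun_mul (by fun_prop) (by fun_prop)]
  simp only [iteratedDeriv_exp_mul_sin_zero]
end

section
/- Let n ∈ ℕ, let x ∈ ℝ with -1 ≤ x ≤ 1, let r ∈ ℕ with r ≥ 1 and u_1, …, u_r ∈ ℝ. Then the n-th derivative at t = 0 of t ↦ exp(x t + Σ_{j=1}^r u_j t^j) · cos(√(1-x²) · t) equals Σ_{j=0}^{n} (n choose j) · H_j(u, r) · T_{n-j}(x), where T_m denotes the Chebyshev polynomial of the first kind evaluated at x. (That is, P₃(n, x, u, r) = Σ_{j=0}^n (n choose j) H_j(u, r) T_{n-j}(x).) -/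
open Finset

theorem iteratedDeriv_exp_mul_cos (m : ℕ) (θ : ℝ) :
    iteratedDeriv m
      (fun t : ℝ => Real.exp (Real.cos θ * t) * Real.cos (Real.sin θ * t)) =
    fun t => Real.exp (Real.cos θ * t) * Real.cos (Real.sin θ * t + m * θ) := by
  induction m with
  | zero => simp
  | succ m ih =>
    rw [iteratedDeriv_succ, ih]
    ext t
    have hexp : HasDerivAt (fun t : ℝ => Real.exp (Real.cos θ * t))
        (Real.exp (Real.cos θ * t) * (Real.cos θ * 1)) t :=
      ((hasDerivAt_id t).const_mul _).exp
    have hcos : HasDerivAt (fun t : ℝ => Real.cos (Real.sin θ * t + m * θ))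
        (-Real.sin (Real.sin θ * t + m * θ) * (Real.sin θ * 1)) t :=
      (((hasDerivAt_id t).const_mul _).add_const _).cos
    rw [(hexp.fun_mul hcos).deriv, Nat.cast_succ, add_one_mul, ← add_assoc, Real.cos_add _ θ]
    ring

theorem iteratedDeriv_exp_mul_cos_zero (m : ℕ) {x : ℝ} (hx : -1 ≤ x) (hx' : x ≤ 1) :
    iteratedDeriv m
      (fun t : ℝ => Real.exp (x * t) * Real.cos (Real.sqrt (1 - x ^ 2) * t)) 0 =
    (Polynomial.Chebyshev.T ℝ m).eval x := by
  have h := congrFun (iteratedDeriv_exp_mul_cos m (Real.arccos x)) 0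
  have hT := Polynomial.Chebyshev.T_real_cos (Real.arccos x) m
  rw [Real.cos_arccos hx hx'] at h hT
  rw [Real.sin_arccos] at h
  rw [h, hT]
  simp

theorem stmt_8 (n : ℕ) (x : ℝ) (hx : -1 ≤ x) (hx' : x ≤ 1)
    (r : ℕ) (hr : 1 ≤ r) (u : ℕ → ℝ) :
    iteratedDeriv n
      (fun t : ℝ => Real.exp (x * t + ∑ j ∈ Finset.Icc 1 r, u j * t ^ j) *
        Real.cos (Real.sqrt (1 - x ^ 2) * t)) 0
    = ∑ j ∈ Finset.range (n + 1),
        (n.choose j : ℝ) *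
          iteratedDeriv j (fun t : ℝ => Real.exp (∑ k ∈ Finset.Icc 1 r, u k * t ^ k)) 0 *
          (Polynomial.Chebyshev.T ℝ ((n : ℤ) - j)).eval x := by
  have hfactor : (fun t : ℝ => Real.exp (x * t + ∑ j ∈ Finset.Icc 1 r, u j * t ^ j) *
        Real.cos (Real.sqrt (1 - x ^ 2) * t)) =
      (fun t : ℝ => Real.exp (∑ k ∈ Finset.Icc 1 r, u k * t ^ k)) *
        (fun t : ℝ => Real.exp (x * t) * Real.cos (Real.sqrt (1 - x ^ 2) * t)) := by
    ext t
    rw [Pi.mul_apply, Real.exp_add]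
    ring
  rw [hfactor, iteratedDeriv_mul (by fun_prop) (by fun_prop)]
  refine Finset.sum_congr rfl fun j hj => ?_
  rw [iteratedDeriv_exp_mul_cos_zero _ hx hx', Nat.cast_sub (Finset.mem_range_succ_iff.mp hj)]
end

section
/- Let n ∈ ℕ with n ≥ 1 and let x ∈ ℝ with -1 ≤ x ≤ 1. Then the n-th derivative at t = 0 of t ↦ (2/(e^t + 1)) · exp(x t) · sin(√(1-x²) · t) equals √(1-x²) · Σ_{j=1}^{n} (n choose j) · U_{j-1}(x) · E_{n-j}, where E_m is the m-th derivative at t = 0 of t ↦ 2/(e^t + 1) and U_{j-1} is the Chebyshev polynomial of the second kind evaluated at x. (That is, the sine-Euler polynomial satisfies E_n^{(S)}(x, √(1-x²)) = √(1-x²) Σ_{j=1}^n (n choose j) U_{j-1}(x) E_{n-j}.) -/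
open Finset

/-- The `k`-th derivative of `exp (t cos θ) sin (t sin θ)` shifts the phase by `k θ`. -/
theorem iteratedDeriv_exp_cos_mul_sin_sin (θ : ℝ) (k : ℕ) :
    iteratedDeriv k (fun t : ℝ => Real.exp (Real.cos θ * t) * Real.sin (Real.sin θ * t)) =
      fun t : ℝ => Real.exp (Real.cos θ * t) * Real.sin (Real.sin θ * t + k * θ) := by
  induction k with
  | zero => simp
  | succ k ih =>
    rw [iteratedDeriv_succ, ih]
    funext t
    have hexp : HasDerivAt (fun t : ℝ => Real.exp (Real.cos θ * t))
        (Real.exp (Real.cos θ * t) * (Real.cos θ * 1)) t :=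
      ((hasDerivAt_id t).const_mul _).exp
    have hsin : HasDerivAt (fun t : ℝ => Real.sin (Real.sin θ * t + k * θ))
        (Real.cos (Real.sin θ * t + k * θ) * (Real.sin θ * 1)) t :=
      (((hasDerivAt_id t).const_mul _).add_const _).sin
    rw [(hexp.fun_mul hsin).deriv]
    have hphase : Real.sin θ * t + ((k + 1 : ℕ) : ℝ) * θ = (Real.sin θ * t + k * θ) + θ := by
      push_cast
      ring
    rw [hphase, Real.sin_add _ θ]
    ring

theorem stmt_17 (n : ℕ) (hn : 1 ≤ n) (x : ℝ) (hx : -1 ≤ x) (hx' : x ≤ 1) :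
    iteratedDeriv n
      (fun t : ℝ => 2 / (Real.exp t + 1) * Real.exp (x * t) *
        Real.sin (Real.sqrt (1 - x ^ 2) * t)) 0
    = Real.sqrt (1 - x ^ 2) *
        ∑ j ∈ Finset.Icc 1 n,
          (n.choose j : ℝ) * (Polynomial.Chebyshev.U ℝ ((j : ℤ) - 1)).eval x *
            iteratedDeriv (n - j) (fun t : ℝ => 2 / (Real.exp t + 1)) 0 := by
  obtain ⟨θ, rfl, hθ⟩ : ∃ θ, Real.cos θ = x ∧ Real.sin θ = Real.sqrt (1 - x ^ 2) :=
    ⟨Real.arccos x, Real.cos_arccos hx hx', Real.sin_arccos x⟩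
  rw [← hθ]
  have hprod : (fun t : ℝ => 2 / (Real.exp t + 1) * Real.exp (Real.cos θ * t) *
        Real.sin (Real.sin θ * t)) =
      (fun t : ℝ => Real.exp (Real.cos θ * t) * Real.sin (Real.sin θ * t)) *
        (fun t : ℝ => 2 / (Real.exp t + 1)) := by
    funext t
    simp only [Pi.mul_apply]
    ring
  have hcont : ContDiffAt ℝ n (fun t : ℝ => 2 / (Real.exp t + 1)) 0 :=
    contDiffAt_const.div (Real.contDiff_exp.contDiffAt.add contDiffAt_const) (by positivity)
  rw [hprod, iteratedDeriv_mul (by fun_prop) hcont, Finset.mul_sum, Finset.range_eq_Ico,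
    Finset.sum_eq_sum_Ico_succ_bot (Nat.succ_pos n)]
  simp only [iteratedDeriv_exp_cos_mul_sin_sin]
  simp only [mul_zero, Real.exp_zero, zero_add, one_mul, Nat.cast_zero, zero_mul, Real.sin_zero]
  refine Finset.sum_congr (by ext; simp) fun j _ => ?_
  have hU := Polynomial.Chebyshev.U_real_cos θ ((j : ℤ) - 1)
  push_cast at hU
  rw [sub_add_cancel] at hU
  rw [← hU]
  ring
end
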